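/- Let k ≥ 1 and let 1 ≤ j ≤ k and r ≥ 0 be integers. Work in the polynomial ring ℚ[t_1,…,t_k] (formally MvPolynomial (Fin k) ℚ). If P ∈ ℚ[X_1,…,X_k] is a polynomial such that P(e_1,…,e_k) = p_{j+r}, where e_1,…,e_k are the elementary symmetric polynomials and p_m is the m-th power sum in t_1,…,t_k, then ((−1)^{j−1}/(j+r)) · (∂P/∂X_j)(e_1,…,e_k) = h_r, where h_r is the complete homogeneous symmetric polynomial of degree r in t_1,…,t_k (with h_0 = 1). -/

import Mathlib

open MvPolynomial

namespace PowerSeries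

variable {R A : Type*} [CommRing R] [CommRing A] [Algebra R A]

theorem one_sub_C_mul_X_mul_mk_pow (a : A) :
    (1 - C a * X) * mk (fun n => a ^ n) = 1 := by
  ext n
  cases n with
  | zero => simp [sub_mul, mul_assoc]
  | succ n => simp [sub_mul, mul_assoc, coeff_succ_X_mul, pow_succ', coeff_one]

/-- A derivation of the coefficient ring, applied to each coefficient of a power series. -/
noncomputable def mapDerivation (d : Derivation R A A) (f : PowerSeries A) : PowerSeries A :=
  mk fun n => d (coeff n f)

@[simp]
theorem coeff_mapDerivation (d : Derivation R A A) (f : PowerSeries A) (n : ℕ) :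
    coeff n (mapDerivation d f) = d (coeff n f) :=
  coeff_mk _ _

theorem mapDerivation_neg (d : Derivation R A A) (f : PowerSeries A) :
    mapDerivation d (-f) = -mapDerivation d f := by
  ext n
  simp

theorem mapDerivation_mul (d : Derivation R A A) (f g : PowerSeries A) :
    mapDerivation d (f * g) = mapDerivation d f * g + f * mapDerivation d g := by
  ext n
  simp only [coeff_mapDerivation, coeff_mul, map_add, map_sum, Derivation.leibniz, smul_eq_mul,
    ← Finset.sum_add_distrib]
  exact Finset.sum_congr rfl fun _ _ => by ring

theorem mapDerivation_derivative (d : Derivation R A A) (f : PowerSeries A) :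
    mapDerivation d (derivative A f) = derivative A (mapDerivation d f) := by
  ext n
  have h : d ((n : A) + 1) = 0 := by
    rw [← Nat.cast_succ]
    exact d.map_natCast _
  simp [coeff_derivative, h, mul_comm]

theorem map_derivative {B : Type*} [CommRing B] (φ : A →+* B) (f : PowerSeries A) :
    map φ (derivative A f) = derivative B (map φ f) := by
  ext n
  simp [coeff_derivative]

end PowerSeries

namespace MvPolynomial

variable (σ R : Type*) [Fintype σ] [CommRing R]

/-- The generating function `∑ (-1)ⁿ eₙ zⁿ` of the signed elementary symmetric polynomials. -/
noncomputable def esymmSeries : PowerSeries (MvPolynomial σ R) :=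
  PowerSeries.mk fun n => (-1) ^ n * esymm σ R n

/-- The generating function `∑ hₙ zⁿ` of the complete homogeneous symmetric polynomials. -/
noncomputable def hsymmSeries [DecidableEq σ] : PowerSeries (MvPolynomial σ R) :=
  PowerSeries.mk (hsymm σ R)

/-- The generating function `∑ pₙ₊₁ zⁿ` of the power sums. -/
noncomputable def psumSeries : PowerSeries (MvPolynomial σ R) :=
  PowerSeries.mk fun n => psum σ R (n + 1)

theorem esymmSeries_eq_prod :
    esymmSeries σ R = ∏ i : σ, (1 - PowerSeries.C (X i) * PowerSeries.X) := by
  classical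
  ext1 n
  simp only [sub_eq_add_neg, Finset.prod_one_add, map_sum, esymmSeries, PowerSeries.coeff_mk]
  have key (s : Finset σ) :
      PowerSeries.coeff n (∏ i ∈ s, -(PowerSeries.C (X i : MvPolynomial σ R) * PowerSeries.X)) =
        if s.card = n then (-1) ^ n * ∏ i ∈ s, X i else 0 := by
    rw [Finset.prod_neg, Finset.prod_mul_distrib, Finset.prod_const, ← map_prod,
      show ((-1) ^ s.card : PowerSeries (MvPolynomial σ R)) =
        PowerSeries.C ((-1) ^ s.card) by simp, ← mul_assoc, ← map_mul,
      PowerSeries.coeff_C_mul, PowerSeries.coeff_X_pow]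
    by_cases h : s.card = n
    · simp [h]
    · simp [h, Ne.symm h]
  simp only [key]
  rw [← Finset.sum_filter, esymm, Finset.mul_sum, Finset.powersetCard_eq_filter]

theorem hsymmSeries_eq_prod [DecidableEq σ] :
    hsymmSeries σ R = ∏ i : σ, PowerSeries.mk (fun n => (X i : MvPolynomial σ R) ^ n) := by
  ext1 n
  simp only [hsymmSeries, PowerSeries.coeff_mk, PowerSeries.coeff_prod, hsymm]
  refine Finset.sum_bij (fun s _ => Multiset.toFinsupp s.1) ?_ ?_ ?_ ?_
  · intro s _
    rw [Finset.mem_finsuppAntidiag]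
    refine ⟨?_, Finset.subset_univ _⟩
    exact (Finsupp.sum_fintype _ _ fun _ => rfl).symm.trans
      ((Multiset.toFinsupp_sum_eq s.1).trans s.2)
  · intro s _ t _ h
    exact Subtype.ext (Multiset.toFinsupp.injective h)
  · intro l hl
    rw [Finset.mem_finsuppAntidiag] at hl
    refine ⟨⟨Finsupp.toMultiset l, ?_⟩, Finset.mem_univ _, by simp⟩
    rw [Finsupp.card_toMultiset, Finsupp.sum_fintype _ _ (fun _ => rfl)]
    exact hl.1
  · intro s _
    rw [Finset.prod_multiset_map_count]
    refine Finset.prod_subset (Finset.subset_univ _) fun i _ hi => ?_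
    rw [Multiset.mem_toFinset] at hi
    rw [Multiset.count_eq_zero_of_notMem hi, pow_zero]

theorem esymmSeries_mul_hsymmSeries [DecidableEq σ] : esymmSeries σ R * hsymmSeries σ R = 1 := by
  rw [esymmSeries_eq_prod, hsymmSeries_eq_prod, ← Finset.prod_mul_distrib]
  exact Finset.prod_eq_one fun i _ => PowerSeries.one_sub_C_mul_X_mul_mk_pow _

/-- Newton's identities as a logarithmic derivative. -/
theorem derivative_esymmSeries :
    PowerSeries.derivative _ (esymmSeries σ R) = -(esymmSeries σ R * psumSeries σ R) := by
  classical
  have hp : psumSeries σ R = ∑ i : σ, PowerSeries.C (X i) *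
      PowerSeries.mk (fun n => (X i : MvPolynomial σ R) ^ n) := by
    ext1 n
    simp [psumSeries, psum, pow_succ']
  rw [hp, esymmSeries_eq_prod]
  induction (Finset.univ : Finset σ) using Finset.induction_on with
  | empty => simp
  | insert i s hi ih =>
    rw [Finset.prod_insert hi, Finset.sum_insert hi, Derivation.leibniz, ih]
    simp only [map_sub, Derivation.leibniz, PowerSeries.derivative_one, PowerSeries.derivative_C,
      PowerSeries.derivative_X, smul_eq_mul]
    linear_combination (∏ l ∈ s, (1 - PowerSeries.C (X l : MvPolynomial σ R) * PowerSeries.X)) *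
      PowerSeries.C (X i) * PowerSeries.one_sub_C_mul_X_mul_mk_pow (X i : MvPolynomial σ R)

theorem derivative_hsymmSeries [DecidableEq σ] :
    PowerSeries.derivative _ (hsymmSeries σ R) = psumSeries σ R * hsymmSeries σ R := by
  have hEH := esymmSeries_mul_hsymmSeries σ R
  have h := congrArg (PowerSeries.derivative (MvPolynomial σ R)) hEH
  rw [Derivation.leibniz, PowerSeries.derivative_one, derivative_esymmSeries, smul_eq_mul,
    smul_eq_mul] at h
  linear_combination hsymmSeries σ R * h +
    (psumSeries σ R * hsymmSeries σ R - PowerSeries.derivative _ (hsymmSeries σ R)) * hEH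

end MvPolynomial

/-- The signed generating function `1 + ∑ (-1)ⁱ Xᵢ zⁱ` in indeterminates `X₁, …, Xₖ`, which
specializes to `esymmSeries`. -/
noncomputable def universalEsymmSeries (k : ℕ) : PowerSeries (MvPolynomial (Fin k) ℚ) :=
  PowerSeries.mk fun n => (-1) ^ n *
    Nat.casesOn n 1 fun i => if h : i < k then X ⟨i, h⟩ else 0

theorem map_universalEsymmSeries (k : ℕ) :
    PowerSeries.map (aeval (fun i : Fin k => esymm (Fin k) ℚ ((i : ℕ) + 1))).toRingHom
      (universalEsymmSeries k) = esymmSeries (Fin k) ℚ := by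
  ext1 n
  rcases n with _ | i
  · simp [universalEsymmSeries, esymmSeries]
  · by_cases h : i < k
    · simp [universalEsymmSeries, esymmSeries, h]
    · have : esymm (Fin k) ℚ (i + 1) = 0 := by
        rw [esymm, Finset.powersetCard_eq_empty.2 (by simp; omega), Finset.sum_empty]
      simp [universalEsymmSeries, esymmSeries, h, this]

theorem mapDerivation_pderiv_universalEsymmSeries {k : ℕ} (j : Fin k) :
    PowerSeries.mapDerivation (pderiv j) (universalEsymmSeries k) =
      PowerSeries.C ((-1) ^ ((j : ℕ) + 1)) * PowerSeries.X ^ ((j : ℕ) + 1) := by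
  ext1 n
  have hs (m : ℕ) (p : MvPolynomial (Fin k) ℚ) :
      pderiv j ((-1) ^ m * p) = (-1) ^ m * pderiv j p := by
    rcases neg_one_pow_eq_or (MvPolynomial (Fin k) ℚ) m with h | h <;> simp [h]
  rw [PowerSeries.coeff_mapDerivation, PowerSeries.coeff_C_mul, PowerSeries.coeff_X_pow,
    universalEsymmSeries, PowerSeries.coeff_mk, hs]
  rcases n with _ | i
  · simp
  · by_cases h : i = j
    · subst h
      simp
    · by_cases hi : i < k
      · have : (⟨i, hi⟩ : Fin k) ≠ j := fun e => h (congrArg Fin.val e)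
        simp [hi, h, pderiv_X_of_ne this]
      · simp [hi, h]

theorem aeval_esymm_injective (k : ℕ) :
    Function.Injective (aeval (R := ℚ) (fun i : Fin k => esymm (Fin k) ℚ ((i : ℕ) + 1))) := by
  intro p q h
  apply esymmAlgHom_injective (σ := Fin k) ℚ (n := k) (by simp)
  apply Subtype.ext
  simpa only [esymmAlgHom_apply] using h

theorem exists_aeval_esymm_eq_psum (k n : ℕ) :
    ∃ p : MvPolynomial (Fin k) ℚ,
      aeval (fun i : Fin k => esymm (Fin k) ℚ ((i : ℕ) + 1)) p = psum (Fin k) ℚ n := by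
  obtain ⟨p, hp⟩ := (esymmAlgHom_fin_bijective ℚ k).2
    ⟨psum (Fin k) ℚ n, psum_isSymmetric (Fin k) ℚ n⟩
  exact ⟨p, by rw [← esymmAlgHom_apply, hp]⟩

/-- **Gepner's lemma** (Lemma 3.2 of the paper).
In `ℚ[t_1,…,t_k]`, if `P ∈ ℚ[X_1,…,X_k]` satisfies `P(e_1,…,e_k) = p_{j+r}`
(the `(j+r)`-th power sum), where `e_i` are the elementary symmetric polynomials,
then `((-1)^(j-1)/(j+r)) · (∂P/∂X_j)(e_1,…,e_k) = h_r`, the complete homogeneous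
symmetric polynomial of degree `r`.  Here `j : Fin k` encodes the index
`j+1 ∈ {1,…,k}` of the statement. -/
theorem gepner_lemma (k : ℕ) (hk : 1 ≤ k) (j : Fin k) (r : ℕ)
    (P : MvPolynomial (Fin k) ℚ)
    (hP : aeval (fun i : Fin k => esymm (Fin k) ℚ ((i : ℕ) + 1)) P
        = psum (Fin k) ℚ ((j : ℕ) + 1 + r)) :
    ((-1 : ℚ) ^ (j : ℕ) / (((j : ℕ) + 1 + r : ℕ) : ℚ)) •
        aeval (fun i : Fin k => esymm (Fin k) ℚ ((i : ℕ) + 1)) (pderiv j P)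
      = hsymm (Fin k) ℚ r := by
  set φ := aeval (R := ℚ) (fun i : Fin k => esymm (Fin k) ℚ ((i : ℕ) + 1)) with hφ
  choose Q hQ using exists_aeval_esymm_eq_psum k
  have hPQ : P = Q ((j : ℕ) + r + 1) := by
    apply aeval_esymm_injective k
    rw [hQ, ← hφ, hP, add_right_comm]
  set S : PowerSeries (MvPolynomial (Fin k) ℚ) := PowerSeries.mk fun n => Q (n + 1) with hS
  have hmapS : PowerSeries.map φ.toRingHom S = psumSeries (Fin k) ℚ := by
    ext1 n
    rw [PowerSeries.coeff_map, hS, psumSeries, PowerSeries.coeff_mk, PowerSeries.coeff_mk]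
    exact hQ (n + 1)
  have hmapE : PowerSeries.map φ.toRingHom (universalEsymmSeries k) = esymmSeries (Fin k) ℚ :=
    map_universalEsymmSeries k
  have hNewton : PowerSeries.derivative _ (universalEsymmSeries k) =
      -(universalEsymmSeries k * S) := by
    apply PowerSeries.map_injective φ.toRingHom (aeval_esymm_injective k)
    rw [PowerSeries.map_derivative, map_neg, map_mul, hmapS, hmapE, derivative_esymmSeries]
  have hD := congrArg (fun f => PowerSeries.map φ.toRingHom
    (PowerSeries.mapDerivation (pderiv j) f)) hNewton
  simp only [PowerSeries.mapDerivation_derivative, PowerSeries.mapDerivation_neg,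
    PowerSeries.mapDerivation_mul, PowerSeries.map_derivative, map_neg, map_add, map_mul, hmapS,
    hmapE] at hD
  set G := PowerSeries.map φ.toRingHom
    (PowerSeries.mapDerivation (pderiv j) (universalEsymmSeries k)) with hG
  set Y := PowerSeries.map φ.toRingHom (PowerSeries.mapDerivation (pderiv j) S) with hY
  have hYG : Y = -PowerSeries.derivative _ (G * hsymmSeries (Fin k) ℚ) := by
    rw [Derivation.leibniz, derivative_hsymmSeries, smul_eq_mul, smul_eq_mul]
    linear_combination hsymmSeries (Fin k) ℚ * hD - Y * esymmSeries_mul_hsymmSeries (Fin k) ℚ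
  have hGval : G = PowerSeries.C ((-1) ^ ((j : ℕ) + 1)) * PowerSeries.X ^ ((j : ℕ) + 1) := by
    rw [hG, mapDerivation_pderiv_universalEsymmSeries]
    simp
  have hc := congrArg (PowerSeries.coeff ((j : ℕ) + r)) hYG
  rw [hGval, map_neg, PowerSeries.coeff_derivative, mul_assoc, PowerSeries.coeff_C_mul,
    show (j : ℕ) + r + 1 = r + ((j : ℕ) + 1) by ring, PowerSeries.coeff_X_pow_mul] at hc
  have hYc : PowerSeries.coeff ((j : ℕ) + r) Y = φ (pderiv j P) := by
    simp [hY, hS, hPQ]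
  rw [hYc, hsymmSeries, PowerSeries.coeff_mk] at hc
  rw [hc, smul_eq_C_mul]
  have hn : (((j : ℕ) + 1 + r : ℕ) : ℚ) ≠ 0 := by positivity
  have hs : ((-1 : ℚ) ^ (j : ℕ) / (((j : ℕ) + 1 + r : ℕ) : ℚ)) *
      (-((-1) ^ ((j : ℕ) + 1) * (((j : ℕ) + 1 + r : ℕ) : ℚ))) = 1 := by
    have h1 : ((-1 : ℚ) ^ (j : ℕ)) * (-1) ^ (j : ℕ) = 1 := by
      rw [← mul_pow]
      simp
    field_simp
    linear_combination h1
  have hs' := congrArg (C : ℚ → MvPolynomial (Fin k) ℚ) hs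
  rw [map_mul, map_one, map_neg, map_mul, map_pow, map_neg, map_one, map_natCast C] at hs'
  push_cast at hs' ⊢
  linear_combination hsymm (Fin k) ℚ r * hs'
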